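/- Let b ∈ ℝ and c > −1, with b = 0 in case c = −1/2, and let μ be a normalized free Meixner distribution with parameters b, c. Then the operator Q[f] = (1 + b x + c x²) L_μ[L_μ[f]] − (b + (1 + 2c) x) L_μ[f] on ℝ[x] has a polynomial system of eigenfunctions, with eigenvalues λ_0 = 0, λ_1 = −(1 + 2c), and λ_n = −(1 + c) for n ≥ 2. Moreover, this choice of coefficients is unique up to a scalar factor: if p, q ∈ ℝ[x] are such that f ↦ p · L_μ[L_μ[f]] + q · L_μ[f] has a polynomial system of eigenfunctions, then there is λ ∈ ℝ with p(x) = λ(1 + b x + c x²) and q(x) = −λ(b + (1 + 2c) x). -/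

import Mathlib

open MeasureTheory Polynomial

/-- Moments of a measure on ℝ. -/
noncomputable def mom (ρ : Measure ℝ) (k : ℕ) : ℝ := ∫ x, x ^ k ∂ρ

/-- The operator `L_ρ` on polynomials, defined via the moment sequence `m` of `ρ`:
`L[x^n] = Σ_{k=0}^{n-1} m_{n-1-k} x^k`. -/
noncomputable def Lop (m : ℕ → ℝ) (f : Polynomial ℝ) : Polynomial ℝ :=
  f.sum fun n a => C a * ∑ k ∈ Finset.range n, C (m (n - 1 - k)) * X ^ k

/-- A measure has compact support. -/
def CompactSupp (μ : Measure ℝ) : Prop := ∃ K : Set ℝ, IsCompact K ∧ μ Kᶜ = 0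

/-- A polynomial system of eigenfunctions for an operator on polynomials. -/
def HasPolyEigenfunctions (Q : Polynomial ℝ → Polynomial ℝ) : Prop :=
  ∃ (P : ℕ → Polynomial ℝ) (lam : ℕ → ℝ),
    (∀ n, (P n).degree = (n : WithBot ℕ)) ∧ (∀ n, Q (P n) = lam n • P n)

/-- The moment recursion of a normalized free Meixner distribution with parameters `b`, `c`. -/
def FreeMeixnerMoments (b c : ℝ) (m : ℕ → ℝ) : Prop :=
  m 0 = 1 ∧ ∀ n : ℕ, 1 ≤ n →
    (∑ i ∈ Finset.range (n - 1), m i * m (n - 2 - i))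
    + b * (∑ i ∈ Finset.range n, m i * m (n - 1 - i))
    + c * (∑ i ∈ Finset.range (n + 1), m i * m (n - i))
    - b * m (n - 1) - (1 + 2 * c) * m n = 0

/-- linear version of `Lop` -/
noncomputable def LL (m : ℕ → ℝ) : Polynomial ℝ →ₗ[ℝ] Polynomial ℝ where
  toFun := Lop m
  map_add' f g := by
    unfold Lop
    exact Polynomial.sum_add_index f g _ (by simp) (by intros; simp [add_mul])
  map_smul' r f := by
    unfold Lop
    rw [Polynomial.sum_smul_index f r _ (by simp)]
    simp [Polynomial.sum_def, Finset.mul_sum, Polynomial.smul_eq_C_mul, mul_assoc]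

lemma LL_apply (m : ℕ → ℝ) (f) : LL m f = Lop m f := rfl

lemma LL_pow (m : ℕ → ℝ) (n : ℕ) :
    LL m (X ^ n) = ∑ k ∈ Finset.range n, C (m (n - 1 - k)) * X ^ k := by
  rw [LL_apply, Lop, ← Polynomial.monomial_one_right_eq_X_pow, Polynomial.sum_monomial_index _ _ (by simp)]
  simp

lemma LL_pow_succ (m : ℕ → ℝ) (n : ℕ) :
    LL m (X ^ (n + 1)) = X * LL m (X ^ n) + C (m n) := by
  rw [LL_pow, LL_pow, Finset.sum_range_succ', Finset.mul_sum]
  congr 1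
  · apply Finset.sum_congr rfl
    intro k hk
    rw [show n + 1 - 1 - (k + 1) = n - 1 - k by omega]
    ring
  · simp

/-- moment functional -/
noncomputable def ph (m : ℕ → ℝ) : Polynomial ℝ →ₗ[ℝ] ℝ :=
  Polynomial.lsum fun n => (m n) • LinearMap.id

lemma ph_pow (m : ℕ → ℝ) (n : ℕ) (a : ℝ) : ph m (C a * X ^ n) = m n * a := by
  rw [Polynomial.C_mul_X_pow_eq_monomial, ph, Polynomial.lsum_apply,
    Polynomial.sum_monomial_index _ _ (by simp)]
  simp

lemma LL_X_mul (m : ℕ → ℝ) (f : Polynomial ℝ) :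
    LL m (X * f) = X * LL m f + C (ph m f) := by
  induction f using Polynomial.induction_on' with
  | add f g hf hg => rw [mul_add, map_add, map_add, map_add, hf, hg, C_add]; ring
  | monomial n a =>
    rw [← Polynomial.C_mul_X_pow_eq_monomial, ph_pow,
      show X * (C a * X ^ n) = a • (X ^ (n + 1) : Polynomial ℝ) by
        rw [Polynomial.smul_eq_C_mul]; ring,
      ← Polynomial.smul_eq_C_mul, map_smul, map_smul, LL_pow_succ]
    simp only [Polynomial.smul_eq_C_mul, C_mul]
    ring

/-- convolution of moments -/
noncomputable def sm (m : ℕ → ℝ) (j : ℕ) : ℝ := ∑ i ∈ Finset.range (j + 1), m i * m (j - i)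

lemma ph_LL (m : ℕ → ℝ) (n : ℕ) : ph m (LL m (X ^ (n + 1))) = sm m n := by
  rw [LL_pow, map_sum, sm]
  apply Finset.sum_congr rfl
  intro k hk
  rw [ph_pow]
  simp

lemma LL_C (m : ℕ → ℝ) (a : ℝ) : LL m (C a) = 0 := by
  rw [LL_apply, Lop, ← Polynomial.monomial_zero_left, Polynomial.sum_monomial_index _ _ (by simp)]
  simp

lemma LL_one (m : ℕ → ℝ) : LL m 1 = 0 := LL_C m 1

lemma LL_X (m : ℕ → ℝ) : LL m X = C (m 0) := by
  have := LL_pow_succ m 0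
  simpa [LL_one] using this

lemma LL2_pow (m : ℕ → ℝ) (n : ℕ) :
    LL m (LL m (X ^ (n + 2))) = X * LL m (LL m (X ^ (n + 1))) + C (sm m n) := by
  rw [LL_pow_succ m (n + 1), map_add, LL_C, LL_X_mul, ph_LL]; ring

lemma rec_sm {b c : ℝ} {m : ℕ → ℝ} (h : FreeMeixnerMoments b c m) (n : ℕ) :
    sm m n + b * sm m (n + 1) + c * sm m (n + 2) - b * m (n + 1) - (1 + 2 * c) * m (n + 2) = 0 :=
  h.2 (n + 2) (by omega)

lemma m_one {b c : ℝ} {m : ℕ → ℝ} (h : FreeMeixnerMoments b c m) : m 1 = 0 := by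
  have h1 := h.2 1 le_rfl
  simp [Finset.sum_range_succ, h.1] at h1
  linarith

/-- The operator -/
noncomputable def QQ (m : ℕ → ℝ) (p q : Polynomial ℝ) : Polynomial ℝ →ₗ[ℝ] Polynomial ℝ :=
  (LinearMap.mulLeft ℝ p) ∘ₗ (LL m) ∘ₗ (LL m) + (LinearMap.mulLeft ℝ q) ∘ₗ (LL m)

lemma QQ_apply (m : ℕ → ℝ) (p q f : Polynomial ℝ) :
    QQ m p q f = p * Lop m (Lop m f) + q * Lop m f := rfl

lemma QQ_apply' (m : ℕ → ℝ) (p q f : Polynomial ℝ) :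
    QQ m p q f = p * LL m (LL m f) + q * LL m f := rfl

lemma QQ_pow (m : ℕ → ℝ) (p q : Polynomial ℝ) (n : ℕ) :
    QQ m p q (X ^ (n + 2)) = X * QQ m p q (X ^ (n + 1)) + p * C (sm m n) + q * C (m (n + 1)) := by
  rw [QQ_apply', QQ_apply', LL2_pow, LL_pow_succ m (n + 1)]; ring

lemma QQ_one (m : ℕ → ℝ) (p q : Polynomial ℝ) : QQ m p q 1 = 0 := by
  simp [QQ_apply', LL_one]

lemma QQ_C (m : ℕ → ℝ) (p q : Polynomial ℝ) (a : ℝ) : QQ m p q (C a) = 0 := by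
  simp [QQ_apply', LL_C]

lemma QQ_X (m : ℕ → ℝ) (h0 : m 0 = 1) (p q : Polynomial ℝ) : QQ m p q X = q := by
  rw [QQ_apply', LL_X, LL_C, h0]; simp

lemma key {b c : ℝ} {m : ℕ → ℝ} (h : FreeMeixnerMoments b c m) (n : ℕ) :
    QQ m (1 + C b * X + C c * X ^ 2) (-(C b + C (1 + 2 * c) * X)) (X ^ (n + 1))
      + C (1 + c) * X ^ (n + 1) =
    -(C b + C c * X) * C (sm m n) - C c * C (sm m (n + 1)) + C (1 + 2 * c) * C (m (n + 1)) := by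
  induction n with
  | zero =>
    have h0 : sm m 0 = 1 := by simp [sm, h.1]
    have h1 : sm m 1 = 0 := by simp [sm, Finset.sum_range_succ, m_one h]
    rw [zero_add, pow_one, QQ_X m h.1, h0, h1, m_one h]
    simp only [map_add, map_mul, map_one, map_zero, map_ofNat]
    ring
  | succ n ih =>
    rw [QQ_pow]
    have hr := congrArg C (rec_sm h n)
    simp only [map_add, map_sub, map_mul, map_one, map_zero, map_ofNat] at hr ih ⊢
    linear_combination X * ih + hr

lemma exist_part {b c : ℝ} {m : ℕ → ℝ} (hc : -1 < c) (hbc : c = -(1/2) → b = 0)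
    (h : FreeMeixnerMoments b c m) :
    ∃ (P : ℕ → Polynomial ℝ) (lam : ℕ → ℝ),
      (∀ n, (P n).degree = (n : WithBot ℕ)) ∧
      (∀ n, (1 + C b * X + C c * X ^ 2) * Lop m (Lop m (P n))
          - (C b + C (1 + 2 * c) * X) * Lop m (P n) = lam n • P n) ∧
      lam 0 = 0 ∧ lam 1 = -(1 + 2 * c) ∧ ∀ n : ℕ, 2 ≤ n → lam n = -(1 + c) := by
  refine ⟨fun n => match n with
    | 0 => 1
    | 1 => X + C (b / (1 + 2 * c))
    | (n + 2) => X ^ (n + 2) + (C (- sm m (n + 1)) * X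
        + C ((c * sm m (n + 2) - (1 + 2 * c) * m (n + 2)) / (1 + c))),
    fun n => match n with
    | 0 => 0
    | 1 => -(1 + 2 * c)
    | (n + 2) => -(1 + c), ?_, ?_, rfl, rfl, ?_⟩
  · intro n
    match n with
    | 0 => simp
    | 1 => simp
    | (n + 2) =>
      simp only
      rw [Polynomial.degree_add_eq_left_of_degree_lt]
      · simp
      · rw [Polynomial.degree_X_pow]
        refine lt_of_le_of_lt Polynomial.degree_linear_le ?_
        exact_mod_cast (by omega : 1 < n + 2)
  · intro n
    rw [sub_eq_add_neg, ← neg_mul, ← QQ_apply]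
    match n with
    | 0 => simp [QQ_one]
    | 1 =>
      simp only
      rw [map_add, QQ_C, QQ_X m h.1, Polynomial.smul_eq_C_mul]
      have : (1 + 2 * c) * (b / (1 + 2 * c)) = b := by
        by_cases h1 : 1 + 2 * c = 0
        · rw [hbc (by linarith)]; simp
        · field_simp
      have := congrArg C this
      rw [C_mul] at this
      rw [C_neg]
      linear_combination this
    | (n + 2) =>
      simp only
      have hk := key h (n + 1)
      rw [LinearMap.map_add, LinearMap.map_add, QQ_C,
        ← Polynomial.smul_eq_C_mul (- sm m (n + 1)), LinearMap.map_smul,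
        QQ_X m h.1, Polynomial.smul_eq_C_mul, Polynomial.smul_eq_C_mul, Polynomial.smul_eq_C_mul]
      have h1 : 1 + c ≠ 0 := by linarith
      have := congrArg C (show (1 + c) * ((c * sm m (n + 2) - (1 + 2 * c) * m (n + 2)) / (1 + c))
        = c * sm m (n + 2) - (1 + 2 * c) * m (n + 2) by field_simp)
      rw [C_mul] at this
      simp only [map_add, map_sub, map_neg, map_mul, map_one, map_zero, map_ofNat] at hk this ⊢
      linear_combination hk + this
  · intro n hn
    obtain ⟨k, rfl⟩ := Nat.exists_eq_add_of_le' hn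
    rfl

lemma unique_part {b c : ℝ} {m : ℕ → ℝ} (h : FreeMeixnerMoments b c m) (p q : Polynomial ℝ)
    (H : HasPolyEigenfunctions (fun f => p * Lop m (Lop m f) + q * Lop m f)) :
    ∃ l : ℝ, p = C l * (1 + C b * X + C c * X ^ 2) ∧
          q = -(C l * (C b + C (1 + 2 * c) * X)) := by
  obtain ⟨P, lam, hd, hQ⟩ := H
  replace hQ : ∀ n, QQ m p q (P n) = lam n • P n := hQ
  have hnd : ∀ n, (P n).natDegree = n := fun n => Polynomial.natDegree_eq_of_degree_eq_some (hd n)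
  have hlc : ∀ n, (P n).coeff n ≠ 0 := by
    intro n
    exact Polynomial.coeff_ne_zero_of_eq_degree (hd n)
  have m0 := h.1
  have m1 := m_one h
  have s0 : sm m 0 = 1 := by simp [sm, m0]
  have s1 : sm m 1 = 0 := by simp [sm, Finset.sum_range_succ, m1]
  have m2 : m 2 = 1 := by
    have := rec_sm h 0
    simp [sm, Finset.sum_range_succ, m0, m1] at this
    linarith
  have s2 : sm m 2 = 2 := by simp [sm, Finset.sum_range_succ, m0, m1, m2]; norm_num
  have m3 : m 3 = b := by
    have := rec_sm h 1
    simp [sm, Finset.sum_range_succ, m0, m1, m2] at this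
    linarith
  have s3 : sm m 3 = 2 * b := by simp [sm, Finset.sum_range_succ, m0, m1, m2, m3]; ring
  have m4 : m 4 = 2 + c + b ^ 2 := by
    have := rec_sm h 2
    simp [sm, Finset.sum_range_succ, m0, m1, m2, m3] at this
    linarith
  have s4 : sm m 4 = 2 * m 4 + 1 := by simp [sm, Finset.sum_range_succ, m0, m1, m2, m3]; ring
  -- degree bounds
  have hq : q.natDegree ≤ 1 := by
    have h1 := hQ 1
    rw [Polynomial.eq_X_add_C_of_natDegree_le_one (hnd 1).le, map_add, QQ_C,
      ← Polynomial.smul_eq_C_mul, map_smul, QQ_X m m0, add_zero] at h1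
    have : q = ((P 1).coeff 1)⁻¹ • (lam 1 • ((P 1).coeff 1 • X + C ((P 1).coeff 0))) := by
      rw [← h1, smul_smul, inv_mul_cancel₀ (hlc 1), one_smul]
    rw [this, Polynomial.smul_eq_C_mul _ (p := X)]
    exact (Polynomial.natDegree_smul_le _ _).trans ((Polynomial.natDegree_smul_le _ _).trans
      Polynomial.natDegree_linear_le)
  have hQ2 : QQ m p q (X ^ 2) = X * q + p := by
    have := QQ_pow m p q 0
    rw [zero_add, pow_one, QQ_X m m0, s0, m1] at this
    simpa using this
  have hp : p.natDegree ≤ 2 := by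
    have h2 := hQ 2
    have e2 : P 2 = (P 2).coeff 2 • X ^ 2 + ((P 2).coeff 1 • X + C ((P 2).coeff 0)) := by
      conv_lhs => rw [Polynomial.as_sum_range_C_mul_X_pow (P 2), hnd 2]
      simp [Finset.sum_range_succ, Polynomial.smul_eq_C_mul]
      ring
    have h3 : QQ m p q (P 2) = (P 2).coeff 2 • (X * q + p) + (P 2).coeff 1 • q := by
      conv_lhs => rw [e2]
      rw [map_add, map_add, map_smul, map_smul, QQ_C, QQ_X m m0, hQ2, add_zero]
    have : p = ((P 2).coeff 2)⁻¹ • (lam 2 • P 2 - (P 2).coeff 1 • q) - X * q := by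
      rw [← h2, h3, add_sub_cancel_right, smul_smul, inv_mul_cancel₀ (hlc 2), one_smul]
      ring
    rw [this]
    refine Polynomial.natDegree_sub_le_of_le (n := 2) ((Polynomial.natDegree_smul_le _ _).trans
      (Polynomial.natDegree_sub_le_of_le ((Polynomial.natDegree_smul_le _ _).trans (hnd 2).le)
        ((Polynomial.natDegree_smul_le _ _).trans (hq.trans one_le_two)))) ?_
    exact Polynomial.natDegree_mul_le.trans (by rw [Polynomial.natDegree_X]; omega)
  have hqc : ∀ k, 2 ≤ k → q.coeff k = 0 := fun k hk =>
    Polynomial.coeff_eq_zero_of_natDegree_lt (by omega)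
  have hpc : ∀ k, 3 ≤ k → p.coeff k = 0 := fun k hk =>
    Polynomial.coeff_eq_zero_of_natDegree_lt (by omega)
  -- leading terms
  have hF : ∀ n k, n + 2 ≤ k → (QQ m p q (X ^ (n + 2))).coeff k =
      if k = n + 2 then p.coeff 2 + q.coeff 1 else 0 := by
    intro n
    induction n with
    | zero =>
      intro k hk
      obtain ⟨j, rfl⟩ := Nat.exists_eq_add_of_le' hk
      rw [zero_add, hQ2, Polynomial.coeff_add, show j + (0 + 2) = (j + 1) + 1 by omega,
        Polynomial.coeff_X_mul]
      rcases j with _ | j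
      · simp; ring
      · rw [hqc _ (by omega), hpc _ (by omega)]; simp
    | succ n ih =>
      intro k hk
      obtain ⟨j, rfl⟩ := Nat.exists_eq_add_of_le' hk
      rw [show n + 1 + 2 = (n + 1) + 2 by omega, QQ_pow, Polynomial.coeff_add, Polynomial.coeff_add,
        Polynomial.coeff_mul_C, Polynomial.coeff_mul_C, hqc _ (by omega), hpc _ (by omega),
        show j + (n + 1 + 2) = (j + n + 2) + 1 by omega, Polynomial.coeff_X_mul, ih _ (by omega)]
      simp
  have hF' : ∀ i k, 2 ≤ k → i ≤ k → (QQ m p q (X ^ i)).coeff k =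
      if k = i then p.coeff 2 + q.coeff 1 else 0 := by
    intro i k hk hik
    match i, hik with
    | 0, _ => rw [pow_zero, QQ_one, if_neg (by omega)]; simp
    | 1, _ => rw [pow_one, QQ_X m m0, hqc k hk, if_neg (by omega)]
    | (i + 2), hik => exact hF i k hik
  have hlam : ∀ n, 2 ≤ n → lam n = p.coeff 2 + q.coeff 1 := by
    intro n hn
    have h1 : (QQ m p q (P n)).coeff n = (P n).coeff n * (p.coeff 2 + q.coeff 1) := by
      conv_lhs => rw [Polynomial.as_sum_range_C_mul_X_pow (P n), hnd n]
      rw [map_sum, Polynomial.finsetSum_coeff, Finset.sum_eq_single n]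
      · rw [← Polynomial.smul_eq_C_mul, map_smul, Polynomial.coeff_smul, hF' n n hn le_rfl]
        simp
      · intro i hi hin
        have : i ≤ n := by simpa [Nat.lt_succ_iff] using hi
        rw [← Polynomial.smul_eq_C_mul, map_smul, Polynomial.coeff_smul, hF' i n hn this,
          if_neg (Ne.symm hin)]
        simp
      · simp
    rw [hQ n, Polynomial.coeff_smul, smul_eq_mul, mul_comm] at h1
    exact mul_left_cancel₀ (hlc n) h1
  -- image in the span of 1, X
  have himg : ∀ f : Polynomial ℝ, ∀ k, 2 ≤ k →
      (QQ m p q f).coeff k = (p.coeff 2 + q.coeff 1) * f.coeff k := by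
    intro f k hk
    let S : Polynomial.Sequence ℝ := ⟨P, hd⟩
    have hspan := S.span (fun i => isUnit_iff_ne_zero.2 (by
      rw [Polynomial.leadingCoeff_ne_zero]; exact S.ne_zero i))
    have hf : f ∈ Submodule.span ℝ (Set.range S) := by rw [hspan]; trivial
    induction hf using Submodule.span_induction with
    | mem x hx =>
      obtain ⟨n, rfl⟩ := hx
      change (QQ m p q (P n)).coeff k = _ * (P n).coeff k
      rw [hQ n, Polynomial.coeff_smul, smul_eq_mul]
      by_cases hn : 2 ≤ n
      · rw [hlam n hn]
      · rw [Polynomial.coeff_eq_zero_of_natDegree_lt (p := P n) (by rw [hnd n]; omega)]; simp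
    | zero => simp
    | add x y _ _ hx hy => rw [map_add, Polynomial.coeff_add, Polynomial.coeff_add, hx, hy]; ring
    | smul a x _ hx => rw [map_smul, Polynomial.coeff_smul, Polynomial.coeff_smul, hx]; simp; ring
  have hQ3 := QQ_pow m p q 1
  have hQ4 := QQ_pow m p q 2
  have hQ5 := QQ_pow m p q 3
  have hQ6 := QQ_pow m p q 4
  norm_num only at hQ3 hQ4 hQ5 hQ6
  have q2 := hqc 2 le_rfl
  have e3 := himg (X ^ 3) 2 le_rfl
  have e4 := himg (X ^ 4) 2 le_rfl
  have e5 := himg (X ^ 5) 2 le_rfl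
  have e6 := himg (X ^ 6) 2 le_rfl
  rw [hQ3, hQ2] at e3
  rw [hQ4, hQ3, hQ2] at e4
  rw [hQ5, hQ4, hQ3, hQ2] at e5
  rw [hQ6, hQ5, hQ4, hQ3, hQ2] at e6
  simp only [Polynomial.coeff_add, Polynomial.coeff_mul_C, Polynomial.coeff_X_mul,
    Polynomial.coeff_X_mul_zero, Polynomial.coeff_X_pow, q2, s1, s2, s3, s4, m2, m3] at e3 e4 e5 e6
  simp at e3 e4 e5 e6
  rw [m4] at e6
  have hp1 : p.coeff 1 = b * p.coeff 0 := by linear_combination e5 - e3 - b * e4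
  have hq0 : q.coeff 0 = -(b * p.coeff 0) := by linear_combination e3 - hp1
  have hp2 : p.coeff 2 = c * p.coeff 0 := by
    linear_combination e6 - (2 + c + b ^ 2) * e4 - 2 * b * hp1 - b * hq0
  have hq1 : q.coeff 1 = -((1 + 2 * c) * p.coeff 0) := by linear_combination e4 - 2 * hp2
  refine ⟨p.coeff 0, ?_, ?_⟩
  · conv_lhs => rw [Polynomial.as_sum_range_C_mul_X_pow' p (Nat.lt_succ_of_le hp)]
    simp [Finset.sum_range_succ, hp1, hp2]
    ring
  · conv_lhs => rw [Polynomial.eq_X_add_C_of_natDegree_le_one hq, hq0, hq1]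
    simp
    ring

theorem stmt3 (μ : Measure ℝ) [IsProbabilityMeasure μ] (hcs : CompactSupp μ)
    (b c : ℝ) (hc : -1 < c) (hbc : c = -(1/2) → b = 0)
    (hμ : FreeMeixnerMoments b c (mom μ)) :
    (∃ (P : ℕ → Polynomial ℝ) (lam : ℕ → ℝ),
      (∀ n, (P n).degree = (n : WithBot ℕ)) ∧
      (∀ n, (1 + C b * X + C c * X ^ 2) * Lop (mom μ) (Lop (mom μ) (P n))
          - (C b + C (1 + 2 * c) * X) * Lop (mom μ) (P n) = lam n • P n) ∧
      lam 0 = 0 ∧ lam 1 = -(1 + 2 * c) ∧ ∀ n : ℕ, 2 ≤ n → lam n = -(1 + c))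
    ∧ ∀ p q : Polynomial ℝ,
        HasPolyEigenfunctions
          (fun f => p * Lop (mom μ) (Lop (mom μ) f) + q * Lop (mom μ) f) →
        ∃ l : ℝ, p = C l * (1 + C b * X + C c * X ^ 2) ∧
          q = -(C l * (C b + C (1 + 2 * c) * X)) := by
  exact ⟨exist_part hc hbc hμ, unique_part hμ⟩
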